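/- Let (Ũ, G, π) be a uniformizing system of dimension n. Then the set Ũ_G := {x̃ ∈ Ũ : g(x̃) ≠ x̃ for every g ∈ G with g ≠ id_Ũ} of points of Ũ with trivial stabilizer is open and dense in Ũ. -/

import Mathlib

open Set

noncomputable section

/-- `ℂⁿ`. -/
abbrev CC (n : ℕ) : Type := EuclideanSpace ℂ (Fin n)

/-- A (reduced complex) uniformizing system of dimension `n` for the open set
`U := p '' Ut` of `X`: `Ut ⊆ ℂⁿ` is a nonempty connected open set, `G` is a finite
group of holomorphic automorphisms of `Ut` (encoded as total maps that agree with the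
identity outside `Ut`, so that `G` is honestly a set of maps closed under composition
and inversion), and `p` (the map `π`) is continuous, surjective and `G`-invariant on
`Ut`, inducing a homeomorphism `Ut/G ≃ U` (encoded by: the fibres of `p` on `Ut` are
exactly the `G`-orbits and `p` is an open map on `Ut`). -/
structure UniformizingSystem (n : ℕ) (X : Type*) [TopologicalSpace X] where
  Ut : Set (CC n)
  isOpen_Ut : IsOpen Ut
  isConnected_Ut : IsConnected Ut
  G : Set (CC n → CC n)
  finite_G : G.Finite
  id_mem_G : (id : CC n → CC n) ∈ G
  comp_mem_G : ∀ g ∈ G, ∀ h ∈ G, (g ∘ h) ∈ G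
  inv_mem_G : ∀ g ∈ G, ∃ g' ∈ G, (∀ x, g' (g x) = x) ∧ (∀ x, g (g' x) = x)
  mapsTo_G : ∀ g ∈ G, Set.MapsTo g Ut Ut
  eqOn_id_G : ∀ g ∈ G, Set.EqOn g id Utᶜ
  analytic_G : ∀ g ∈ G, AnalyticOnNhd ℂ g Ut
  p : CC n → X
  continuousOn_p : ContinuousOn p Ut
  isOpen_image_p : IsOpen (p '' Ut)
  invariant_p : ∀ g ∈ G, ∀ x ∈ Ut, p (g x) = p x
  exists_g_of_p_eq : ∀ x ∈ Ut, ∀ y ∈ Ut, p x = p y → ∃ g ∈ G, g x = y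
  isOpenMap_p : ∀ V : Set (CC n), V ⊆ Ut → IsOpen V → IsOpen (p '' V)

/-- The underlying open subset of `X` uniformized by the system. -/
def UniformizingSystem.U {n : ℕ} {X : Type*} [TopologicalSpace X]
    (𝒰 : UniformizingSystem n X) : Set X := 𝒰.p '' 𝒰.Ut

/-- An embedding `l : (Ũ,G,π) → (Ṽ,H,φ)` of uniformizing systems: a holomorphic
embedding (injective, biholomorphism onto its open image) with `φ ∘ l = π` on `Ũ`. -/
structure IsUSEmbedding {n : ℕ} {X : Type*} [TopologicalSpace X]
    (𝒰 𝒱 : UniformizingSystem n X) (l : CC n → CC n) : Prop where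
  mapsTo : Set.MapsTo l 𝒰.Ut 𝒱.Ut
  injOn : Set.InjOn l 𝒰.Ut
  analyticOn : AnalyticOnNhd ℂ l 𝒰.Ut
  isOpen_image : IsOpen (l '' 𝒰.Ut)
  exists_analytic_inv : ∃ m : CC n → CC n,
    AnalyticOnNhd ℂ m (l '' 𝒰.Ut) ∧ ∀ x ∈ 𝒰.Ut, m (l x) = x
  comp_p : ∀ x ∈ 𝒰.Ut, 𝒱.p (l x) = 𝒰.p x

/-- A finite intersection of relatively open, relatively dense subsets of an open set is
open and relatively dense. -/
theorem isOpen_and_subset_closure_biInter {Y ι : Type*} [TopologicalSpace Y] {U : Set Y}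
    (hU : IsOpen U) {S : Set ι} (hS : S.Finite) (P : ι → Y → Prop)
    (hP : ∀ i ∈ S, IsOpen {x ∈ U | P i x} ∧ U ⊆ closure {x ∈ U | P i x}) :
    IsOpen {x ∈ U | ∀ i ∈ S, P i x} ∧ U ⊆ closure {x ∈ U | ∀ i ∈ S, P i x} := by
  induction S, hS using Set.Finite.induction_on with
  | empty => simpa using ⟨hU, subset_closure⟩
  | @insert a S _ _ ih =>
    obtain ⟨hSo, hSd⟩ := ih fun i hi => hP i (mem_insert_of_mem a hi)
    obtain ⟨hao, had⟩ := hP a (mem_insert a S)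
    have h : {x ∈ U | ∀ i ∈ insert a S, P i x} =
        {x ∈ U | P a x} ∩ {x ∈ U | ∀ i ∈ S, P i x} := by
      ext x
      simp only [mem_insert_iff, forall_eq_or_imp, mem_ofPred_eq, mem_inter_iff]
      tauto
    rw [h]
    refine ⟨hao.inter hSo, had.trans (closure_minimal ?_ isClosed_closure)⟩
    exact fun x hx => hao.inter_closure ⟨hx, hSd hx.1⟩

/-- The points moved by an analytic self-map of a preconnected open set form an open set. This set
is relatively dense unless the map is the identity. -/
theorem AnalyticOnNhd.isOpen_and_subset_closure_ne_self {E : Type*} [NormedAddCommGroup E]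
    [NormedSpace ℂ E] {U : Set E} (hU : IsOpen U) (hc : IsPreconnected U) {g : E → E}
    (hg : AnalyticOnNhd ℂ g U) (hne : ∃ y ∈ U, g y ≠ y) :
    IsOpen {x ∈ U | g x ≠ x} ∧ U ⊆ closure {x ∈ U | g x ≠ x} := by
  constructor
  · have h := (hg.continuousOn.sub continuousOn_id).isOpen_inter_preimage hU
      (isOpen_compl_singleton (x := (0 : E)))
    convert h using 1
    ext x
    simp [sub_eq_zero]
  · intro x hx
    by_contra hcl
    obtain ⟨y, hy, hgy⟩ := hne
    have hev : g =ᶠ[nhds x] id := by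
      filter_upwards [isClosed_closure.isOpen_compl.mem_nhds hcl, hU.mem_nhds hx] with z hz hzU
      by_contra hgz
      exact hz (subset_closure ⟨hzU, hgz⟩)
    exact hgy (hg.eqOn_of_preconnected_of_eventuallyEq (fun z _ => analyticAt_id) hc hx hev hy)

/-- For a uniformizing system `(Ũ, G, π)`, the set `Ũ_G` of points of `Ũ` with
trivial stabilizer is open and dense in `Ũ` (here `g ≠ id_Ũ` is expressed by saying
that `g` moves some point of `Ũ`). -/
theorem statement2 {n : ℕ} {X : Type*} [TopologicalSpace X]
    (𝒰 : UniformizingSystem n X) :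
    IsOpen {x ∈ 𝒰.Ut | ∀ g ∈ 𝒰.G, (∃ y ∈ 𝒰.Ut, g y ≠ y) → g x ≠ x} ∧
    𝒰.Ut ⊆ closure {x ∈ 𝒰.Ut | ∀ g ∈ 𝒰.G, (∃ y ∈ 𝒰.Ut, g y ≠ y) → g x ≠ x} := by
  refine isOpen_and_subset_closure_biInter 𝒰.isOpen_Ut 𝒰.finite_G
    (fun g x => (∃ y ∈ 𝒰.Ut, g y ≠ y) → g x ≠ x) fun g hg => ?_
  by_cases hne : ∃ y ∈ 𝒰.Ut, g y ≠ y
  · simpa only [hne, true_imp_iff] using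
      (𝒰.analytic_G g hg).isOpen_and_subset_closure_ne_self 𝒰.isOpen_Ut
        𝒰.isConnected_Ut.isPreconnected hne
  · simpa only [hne, false_imp_iff, and_true, ofPred_mem_eq] using
      ⟨𝒰.isOpen_Ut, subset_closure⟩
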